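/- For all integers n ≥ 3 and k ≥ 2, the number of permutations π in S_n such that π avoids both of the patterns 231 and 321 and π^k avoids the pattern 321 equals 2^{n−1}. -/

import Mathlib

/-- A permutation `π` of `Fin n` contains the pattern `τ` (a permutation of `Fin m`)
if there is a strictly increasing choice of `m` indices on which `π` is
order-isomorphic to `τ`. -/
def PermContains {n m : ℕ} (π : Equiv.Perm (Fin n)) (τ : Equiv.Perm (Fin m)) : Prop :=
  ∃ f : Fin m → Fin n, StrictMono f ∧ ∀ i j : Fin m, τ i < τ j ↔ π (f i) < π (f j)

/-- `π` avoids the pattern `τ`. -/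
def PermAvoids {n m : ℕ} (π : Equiv.Perm (Fin n)) (τ : Equiv.Perm (Fin m)) : Prop :=
  ¬ PermContains π τ

/-- The pattern 123 (one-line notation), as a permutation of `Fin 3`. -/
def p123 : Equiv.Perm (Fin 3) := ⟨![0,1,2], ![0,1,2], by decide, by decide⟩
/-- The pattern 132. -/
def p132 : Equiv.Perm (Fin 3) := ⟨![0,2,1], ![0,2,1], by decide, by decide⟩
/-- The pattern 213. -/
def p213 : Equiv.Perm (Fin 3) := ⟨![1,0,2], ![1,0,2], by decide, by decide⟩
/-- The pattern 231. -/
def p231 : Equiv.Perm (Fin 3) := ⟨![1,2,0], ![2,0,1], by decide, by decide⟩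
/-- The pattern 312. -/
def p312 : Equiv.Perm (Fin 3) := ⟨![2,0,1], ![1,2,0], by decide, by decide⟩
/-- The pattern 321. -/
def p321 : Equiv.Perm (Fin 3) := ⟨![2,1,0], ![2,1,0], by decide, by decide⟩

/-- No entry of `π` is preceded by two larger entries. -/
def AtMostOneLargerBefore {n : ℕ} (π : Equiv.Perm (Fin n)) : Prop :=
  ∀ i j k, i < j → j < k → ¬ (π k < π i ∧ π k < π j)

/-- No entry of `σ` is followed by two smaller entries. -/
def AtMostOneSmallerAfter {n : ℕ} (σ : Equiv.Perm (Fin n)) : Prop :=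
  ∀ i j k, i < j → i < k → σ j < σ i → σ k < σ i → j = k

theorem permContains_p231_iff {n : ℕ} (π : Equiv.Perm (Fin n)) :
    PermContains π p231 ↔ ∃ i j k, i < j ∧ j < k ∧ π k < π i ∧ π i < π j := by
  constructor
  · rintro ⟨f, hf, h⟩
    exact ⟨f 0, f 1, f 2, hf (by decide), hf (by decide), (h 2 0).1 (by decide),
      (h 0 1).1 (by decide)⟩
  · rintro ⟨i, j, k, hij, hjk, h1, h2⟩
    refine ⟨![i, j, k], ?_, ?_⟩
    · intro a b hab
      fin_cases a <;> fin_cases b <;> simp at hab ⊢ <;> omega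
    · intro a b
      fin_cases a <;> fin_cases b <;> simp [p231] <;> omega

theorem permContains_p321_iff {n : ℕ} (π : Equiv.Perm (Fin n)) :
    PermContains π p321 ↔ ∃ i j k, i < j ∧ j < k ∧ π k < π j ∧ π j < π i := by
  constructor
  · rintro ⟨f, hf, h⟩
    exact ⟨f 0, f 1, f 2, hf (by decide), hf (by decide), (h 2 1).1 (by decide),
      (h 1 0).1 (by decide)⟩
  · rintro ⟨i, j, k, hij, hjk, h1, h2⟩
    refine ⟨![i, j, k], ?_, ?_⟩
    · intro a b hab
      fin_cases a <;> fin_cases b <;> simp at hab ⊢ <;> omega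
    · intro a b
      fin_cases a <;> fin_cases b <;> simp [p321] <;> omega

theorem avoids_p231_and_p321_iff {n : ℕ} (π : Equiv.Perm (Fin n)) :
    PermAvoids π p231 ∧ PermAvoids π p321 ↔ AtMostOneLargerBefore π := by
  rw [PermAvoids, PermAvoids, permContains_p231_iff, permContains_p321_iff]
  constructor
  · rintro ⟨h1, h2⟩ i j k hij hjk ⟨hi, hj⟩
    rcases lt_trichotomy (π i) (π j) with h | h | h
    · exact h1 ⟨i, j, k, hij, hjk, hi, h⟩
    · exact hij.ne (π.injective h)
    · exact h2 ⟨i, j, k, hij, hjk, hj, h⟩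
  · intro h
    constructor
    · rintro ⟨i, j, k, hij, hjk, h1, h2⟩
      exact h i j k hij hjk ⟨h1, h1.trans h2⟩
    · rintro ⟨i, j, k, hij, hjk, h1, h2⟩
      exact h i j k hij hjk ⟨h1.trans h2, h1⟩

theorem atMostOneSmallerAfter_inv_iff {n : ℕ} (π : Equiv.Perm (Fin n)) :
    AtMostOneSmallerAfter π⁻¹ ↔ AtMostOneLargerBefore π := by
  constructor
  · rintro h i j k hij hjk ⟨hi, hj⟩
    have := h (π k) (π i) (π j) hi hj (by simpa using hij.trans hjk) (by simpa using hjk)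
    exact hij.ne (π.injective this)
  · intro h i j k hij hik hj hk
    by_contra hne
    rcases lt_or_gt_of_ne (fun e => hne (π⁻¹.injective e)) with hlt | hlt
    · exact h _ _ _ hlt hk (by simpa using ⟨hij, hik⟩)
    · exact h _ _ _ hlt hj (by simpa using ⟨hik, hij⟩)

/-! ### Counting -/

theorem swap_zero_succ_lt_iff {n : ℕ} {p : Fin (n + 2)} (hp : p ≤ 1) (a b : Fin (n + 1)) :
    Equiv.swap 0 p a.succ < Equiv.swap 0 p b.succ ↔ a < b := by
  simp only [Equiv.swap_apply_def, Fin.ext_iff, Fin.lt_def, Fin.le_def] at *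
  simp at *
  split_ifs <;> simp at * <;> omega

theorem atMostOneSmallerAfter_decomposeFin_symm {n : ℕ} (p : Fin (n + 2))
    (e : Equiv.Perm (Fin (n + 1))) :
    AtMostOneSmallerAfter (Equiv.Perm.decomposeFin.symm (p, e)) ↔
      p ≤ 1 ∧ AtMostOneSmallerAfter e := by
  set σ := Equiv.Perm.decomposeFin.symm (p, e) with hσ
  have h0 : σ 0 = p := by simp [hσ]
  have hs : ∀ i : Fin (n + 1), σ i.succ = Equiv.swap 0 p (e i).succ := by simp [hσ]
  have tail (hp : p ≤ 1) (i j : Fin (n + 1)) : σ i.succ < σ j.succ ↔ e i < e j := by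
    rw [hs, hs, swap_zero_succ_lt_iff hp]
  constructor
  · intro h
    have hp : p ≤ 1 := by
      by_contra! hp
      have hpos (v : Fin (n + 2)) (hv : v < p) : 0 < σ⁻¹ v := by
        rw [Fin.pos_iff_ne_zero]
        intro e0
        rw [← e0] at h0
        simp at h0
        exact hv.ne h0
      have h0p : (0 : Fin (n + 2)) < p := lt_trans (by simp) hp
      have := h 0 (σ⁻¹ 0) (σ⁻¹ 1) (hpos _ h0p) (hpos _ hp) (by simpa [h0] using h0p)
        (by simpa [h0] using hp)
      simpa using σ⁻¹.injective this
    refine ⟨hp, fun i j k hij hik hj hk => Fin.succ_injective _ ?_⟩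
    exact h i.succ j.succ k.succ (by simpa) (by simpa) ((tail hp _ _).2 hj) ((tail hp _ _).2 hk)
  · rintro ⟨hp, h⟩ i j k hij hik hj hk
    obtain ⟨j, rfl⟩ := Fin.exists_succ_eq.2 (ne_of_gt (lt_of_le_of_lt (Fin.zero_le _) hij))
    obtain ⟨k, rfl⟩ := Fin.exists_succ_eq.2 (ne_of_gt (lt_of_le_of_lt (Fin.zero_le _) hik))
    induction i using Fin.cases with
    | zero =>
      rw [h0] at hj hk
      apply σ.injective
      simp only [Fin.ext_iff, Fin.lt_def, Fin.le_def, Fin.val_one] at *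
      omega
    | succ i =>
      rw [h i j k (by simpa using hij) (by simpa using hik) ((tail hp _ _).1 hj)
        ((tail hp _ _).1 hk)]

theorem card_atMostOneSmallerAfter (n : ℕ) :
    Nat.card {σ : Equiv.Perm (Fin (n + 1)) // AtMostOneSmallerAfter σ} = 2 ^ n := by
  induction n with
  | zero =>
    have : Unique {σ : Equiv.Perm (Fin 1) // AtMostOneSmallerAfter σ} :=
      { default := ⟨1, fun _ j k _ _ _ _ => Subsingleton.elim j k⟩
        uniq := fun σ => Subtype.ext (Subsingleton.elim _ _) }
    exact Nat.card_unique
  | succ n ih =>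
    have E : {σ : Equiv.Perm (Fin (n + 2)) // AtMostOneSmallerAfter σ} ≃
        {p : Fin (n + 2) // p ≤ 1} ×
          {e : Equiv.Perm (Fin (n + 1)) // AtMostOneSmallerAfter e} :=
      (Equiv.subtypeEquiv Equiv.Perm.decomposeFin fun σ => by
        rw [← atMostOneSmallerAfter_decomposeFin_symm, Prod.mk.eta,
          Equiv.symm_apply_apply]).trans Equiv.subtypeProdEquivProd
    have hp : Nat.card {p : Fin (n + 2) // p ≤ 1} = 2 := by
      rw [Nat.card_eq_fintype_card, Fintype.card_subtype, Finset.filter_ge_eq_Iic, Fin.card_Iic,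
        Fin.val_one]
    rw [Nat.card_congr E, Nat.card_prod, ih, hp, pow_succ']

/-! ### Powers -/

/-- `π` preserves the initial segment of entries smaller than `c`. -/
def IsCut {n : ℕ} (π : Equiv.Perm (Fin n)) (c : ℕ) : Prop :=
  ∀ w, (π w : ℕ) < c ↔ (w : ℕ) < c

/-- No cut of `π` separates `x` and `y`. -/
def SameBlock {n : ℕ} (π : Equiv.Perm (Fin n)) (x y : Fin n) : Prop :=
  ∀ c, IsCut π c → ((x : ℕ) < c ↔ (y : ℕ) < c)

/-- `x`, `y`, `z` are in strict cyclic order. -/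
def InCyclicOrder {n : ℕ} (x y z : Fin n) : Prop :=
  x < y ∧ y < z ∨ y < z ∧ z < x ∨ z < x ∧ x < y

theorem isCut_of_forall {n : ℕ} {π : Equiv.Perm (Fin n)} {c : ℕ}
    (h : ∀ w p : Fin n, (w : ℕ) < c → c ≤ π w → c ≤ p → (π p : ℕ) < c → False) : IsCut π c := by
  have key : ∀ w : Fin n, (w : ℕ) < c → (π w : ℕ) < c := by
    intro w hw
    by_contra! hπ
    have hout : ∀ p : Fin n, c ≤ p → c ≤ π p := fun p hp => by
      by_contra! hlt
      exact h w p hw hπ hp hlt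
    have := Equiv.Perm.perm_symm_on_of_perm_on_finite (f := π)
      (p := fun x : Fin n => c ≤ (x : ℕ)) (fun x hx => hout x hx) hπ
    simp at this
    omega
  refine fun w => ⟨fun hw => ?_, key w⟩
  simpa using Equiv.Perm.perm_symm_on_of_perm_on_finite (f := π)
      (p := fun x : Fin n => (x : ℕ) < c) (fun x hx => key x hx) hw

theorem isCut_of_inversion_left {n : ℕ} {π : Equiv.Perm (Fin n)} (h : AtMostOneLargerBefore π)
    {i j : Fin n} (hij : i < j) (hπ : π j < π i) : IsCut π i := by
  refine isCut_of_forall fun w p hw hπw hp hπp => ?_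
  have hwj : π w < π j := by
    by_contra! hle
    have : π j ≠ π w := fun e => by have := π.injective e; omega
    exact h w i j hw hij ⟨by omega, hπ⟩
  have hpi : p ≠ i := by rintro rfl; omega
  exact h w i p hw (by omega) ⟨by omega, by omega⟩

theorem isCut_of_inversion_right {n : ℕ} {π : Equiv.Perm (Fin n)} (h : AtMostOneLargerBefore π)
    {i j : Fin n} (hij : i < j) (hπ : π j < π i) : IsCut π (π i + 1) := by
  refine isCut_of_forall fun w p hw hπw hp hπp => ?_
  have hwi : w ≠ i := by rintro rfl; omega
  have hwj : w ≠ j := by rintro rfl; omega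
  have hjw : j < w := by
    by_contra! hle
    rcases lt_or_gt_of_ne hwi with hlt | hlt
    · exact h w i j hlt hij ⟨by omega, hπ⟩
    · exact h i w j hlt (by omega) ⟨hπ, by omega⟩
  have hpi : π p ≠ π i := fun e => by have := π.injective e; omega
  exact h i w p (by omega) (by omega) ⟨by omega, by omega⟩

theorem inCyclicOrder_apply_of_lt {n : ℕ} {π : Equiv.Perm (Fin n)} (h : AtMostOneLargerBefore π)
    {x y z : Fin n} (hxy : x < y) (hyz : y < z) (sxy : SameBlock π x y) (syz : SameBlock π y z) :
    InCyclicOrder (π x) (π y) (π z) := by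
  have hne1 : π x ≠ π y := fun e => hxy.ne (π.injective e)
  have hne2 : π y ≠ π z := fun e => hyz.ne (π.injective e)
  have hne3 : π x ≠ π z := fun e => (hxy.trans hyz).ne (π.injective e)
  have hyz' : ¬ π z < π y := fun hlt => by
    have := sxy _ (isCut_of_inversion_left h hyz hlt)
    omega
  have hxy' : π y < π x → ¬ π x < π z := fun hlt hlt' => by
    have hc := isCut_of_inversion_right h hxy hlt
    have h1 := syz _ hc
    have h2 := hc y
    have h3 := hc z
    omega
  unfold InCyclicOrder
  omega

theorem inCyclicOrder_pow_apply {n : ℕ} {π : Equiv.Perm (Fin n)} (h : AtMostOneLargerBefore π)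
    (k : ℕ) {x y z : Fin n} (sxy : SameBlock π x y) (syz : SameBlock π y z)
    (hc : InCyclicOrder x y z) :
    InCyclicOrder ((π ^ k) x) ((π ^ k) y) ((π ^ k) z) := by
  induction k generalizing x y z with
  | zero => simpa
  | succ k ih =>
    have step {a b : Fin n} (s : SameBlock π a b) : SameBlock π (π a) (π b) := fun c hc => by
      rw [hc, hc, s c hc]
    simp only [pow_succ, Equiv.Perm.mul_apply]
    refine ih (step sxy) (step syz) ?_
    have szx : SameBlock π z x := fun c hc => ((sxy c hc).trans (syz c hc)).symm
    rcases hc with ⟨h1, h2⟩ | ⟨h1, h2⟩ | ⟨h1, h2⟩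
    · exact inCyclicOrder_apply_of_lt h h1 h2 sxy syz
    · have := inCyclicOrder_apply_of_lt h h1 h2 syz szx
      unfold InCyclicOrder at *
      tauto
    · have := inCyclicOrder_apply_of_lt h h1 h2 szx sxy
      unfold InCyclicOrder at *
      tauto

theorem IsCut.pow {n : ℕ} {π : Equiv.Perm (Fin n)} {c : ℕ} (h : IsCut π c) (k : ℕ) :
    IsCut (π ^ k) c := by
  induction k with
  | zero => simp [IsCut]
  | succ k ih => intro w; rw [pow_succ, Equiv.Perm.mul_apply, ih, h]

theorem AtMostOneLargerBefore.pow_avoids_p321 {n : ℕ} {π : Equiv.Perm (Fin n)}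
    (h : AtMostOneLargerBefore π) (k : ℕ) : PermAvoids (π ^ k) p321 := by
  rw [PermAvoids, permContains_p321_iff]
  rintro ⟨x, y, z, hxy, hyz, h1, h2⟩
  have same {a b : Fin n} (hab : a < b) (hlt : (π ^ k) b < (π ^ k) a) : SameBlock π a b := by
    intro c hc
    have ha := hc.pow k a
    have hb := hc.pow k b
    omega
  have := inCyclicOrder_pow_apply h k (same hxy h2) (same hyz h1) (Or.inl ⟨hxy, hyz⟩)
  unfold InCyclicOrder at this
  omega

theorem stmt19 (n k : ℕ) (hn : 3 ≤ n) (hk : 2 ≤ k) :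
    Nat.card {π : Equiv.Perm (Fin n) //
      PermAvoids π p231 ∧ PermAvoids π p321 ∧ PermAvoids (π ^ k) p321} =
      2 ^ (n - 1) := by
  obtain ⟨m, rfl⟩ : ∃ m, n = m + 1 := ⟨n - 1, by omega⟩
  rw [Nat.add_sub_cancel, ← card_atMostOneSmallerAfter]
  refine Nat.card_congr (Equiv.subtypeEquiv (Equiv.inv _) fun π => ?_)
  rw [Equiv.inv_apply, atMostOneSmallerAfter_inv_iff, ← and_assoc, avoids_p231_and_p321_iff]
  exact and_iff_left_of_imp fun h => h.pow_avoids_p321 k
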